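/- For every fixed integer m ≥ 2, as z → 1⁻ one has m!·∑_{k≥m} Q_m(k)·z^k ~ 1/((1−z)^m·log^m(1/(1−z))), i.e. (1−z)^m·log^m(1/(1−z))·m!·∑_{k≥m} Q_m(k)·z^k → 1. -/

import Mathlib

open Filter Topology

/-- `Qm m n` is the number of multisets of `m` odd primes whose sum is `n`,
i.e. the number of partitions of `n` into exactly `m` odd prime parts. -/
noncomputable def Qm (m n : ℕ) : ℕ :=
  Nat.card {s : Multiset ℕ // Multiset.card s = m ∧ (∀ p ∈ s, Nat.Prime p ∧ Odd p) ∧ s.sum = n}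

open MeasureTheory FourierTransform in
theorem tendsto_integral_mul_fourier_sub_of_laplace_continuous {b : ℝ → ℝ} {C : ℝ}
    (hbm : Measurable b) (hbC : ∀ u, |b u| ≤ C) (hb0 : ∀ u ≤ 0, b u = 0) {G : ℂ → ℂ}
    (hG : ContinuousOn G {s | 0 ≤ s.re})
    (hbG : ∀ s : ℂ, 0 < s.re → ∫ u : ℝ, (b u : ℂ) * Complex.exp (-(s * u)) = G s)
    {φ : ℝ → ℂ} (hφ : Continuous φ) (hφc : HasCompactSupport φ) (hφi : Integrable (𝓕 φ)) :
    Tendsto (fun y : ℝ => ∫ u : ℝ, (b u : ℂ) * 𝓕 φ (u - y)) atTop (𝓝 0) := by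
  have hφint : Integrable φ := hφ.integrable_of_hasCompactSupport hφc
  have hC : 0 ≤ C := (abs_nonneg _).trans (hbC 0)
  have hφFc : Continuous (𝓕 φ) :=
    VectorFourier.fourierIntegral_continuous Real.continuous_fourierChar (by fun_prop) hφint
  have hcurve : Continuous fun p : Set.Icc (0:ℝ) 1 × ℝ =>
      G ((p.1 : ℝ) + 2 * Real.pi * Complex.I * p.2) := by
    refine hG.comp_continuous (by fun_prop) fun p => ?_
    simpa using p.1.2.1
  have hG0 : Continuous fun ξ : ℝ => G (2 * Real.pi * Complex.I * ξ) := by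
    refine hG.comp_continuous (by fun_prop) fun p => ?_
    simp
  have key : ∀ y : ℝ, ∫ u : ℝ, (b u : ℂ) * 𝓕 φ (u - y) =
      𝓕 (fun ξ : ℝ => G (2 * Real.pi * Complex.I * ξ) * φ ξ) (-y) := by
    intro y
    have hδ : ∀ δ : ℝ, 0 < δ → ∫ u : ℝ, ((b u * Real.exp (-(δ * u)) : ℝ) : ℂ) * 𝓕 φ (u - y) =
        ∫ ξ : ℝ, G (δ + 2 * Real.pi * Complex.I * ξ) *
          (φ ξ * Complex.exp (2 * Real.pi * y * ξ * Complex.I)) := by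
      intro δ hδ
      have hb_int : Integrable fun u : ℝ => ((b u * Real.exp (-(δ * u)) : ℝ) : ℂ) := by
        suffices Integrable fun u : ℝ => b u * Real.exp (-(δ * u)) from this.ofReal
        have h1 : Integrable ((Set.Ioi (0:ℝ)).indicator fun u => C * Real.exp (-δ * u)) :=
          IntegrableOn.integrable_indicator ((exp_neg_integrableOn_Ioi 0 hδ).const_mul C)
            measurableSet_Ioi
        refine h1.mono' (by fun_prop) (Eventually.of_forall fun u => ?_)
        by_cases hu : u ≤ 0
        · simp [hb0 u hu, hu]
        · push Not at hu
          rw [Set.indicator_of_mem (by exact hu), Real.norm_eq_abs, abs_mul, Real.abs_exp, neg_mul]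
          gcongr
          exact hbC u
      have hψ_int : Integrable fun ξ : ℝ =>
          φ ξ * Complex.exp (2 * Real.pi * y * ξ * Complex.I) :=
        (hφ.mul (by fun_prop)).integrable_of_hasCompactSupport hφc.mul_right
      have := VectorFourier.integral_fourierIntegral_smul_eq_flip (μ := volume) (ν := volume)
        (L := innerₗ ℝ) Real.continuous_fourierChar
        (by simpa using (by fun_prop : Continuous fun p : ℝ × ℝ => p.2 * p.1)) hb_int hψ_int
      rw [flip_innerₗ] at this
      change ∫ ξ : ℝ, 𝓕 (fun u : ℝ => ((b u * Real.exp (-(δ * u)) : ℝ) : ℂ)) ξ • _ =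
        ∫ u : ℝ, _ • 𝓕 (fun ξ : ℝ =>
          φ ξ * Complex.exp (2 * Real.pi * y * ξ * Complex.I)) u at this
      simp only [smul_eq_mul] at this
      rw [show (fun u : ℝ => ((b u * Real.exp (-(δ * u)) : ℝ) : ℂ) * 𝓕 φ (u - y)) = fun u : ℝ =>
        ((b u * Real.exp (-(δ * u)) : ℝ) : ℂ) * 𝓕 (fun ξ : ℝ =>
          φ ξ * Complex.exp (2 * Real.pi * y * ξ * Complex.I)) u from ?_, ← this]
      · congr 1
        ext ξ
        congr 1
        rw [← hbG _ (by simpa using hδ), Real.fourier_real_eq_integral_exp_smul]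
        congr 1
        ext u
        push_cast
        rw [smul_eq_mul, mul_left_comm, ← Complex.exp_add]
        congr 2
        ring
      · ext u
        congr 1
        rw [Real.fourier_real_eq_integral_exp_smul, Real.fourier_real_eq_integral_exp_smul]
        congr 1
        ext ξ
        push_cast
        rw [smul_eq_mul, smul_eq_mul, mul_left_comm, ← Complex.exp_add, mul_comm]
        congr 2
        ring
    have hu : Tendsto (fun n : ℕ => (1 / ((n : ℝ) + 1))) atTop (𝓝 0) :=
      tendsto_one_div_add_atTop_nhds_zero_nat
    have hpos : ∀ n : ℕ, 0 < 1 / ((n : ℝ) + 1) := fun n => Nat.one_div_pos_of_nat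
    have hle : ∀ n : ℕ, 1 / ((n : ℝ) + 1) ≤ 1 := fun n => by
      rw [div_le_one (by positivity)]; linarith [n.cast_nonneg (α := ℝ)]
    have hshift : Integrable fun u : ℝ => 𝓕 φ (u - y) := hφi.comp_sub_right y
    have L1 : Tendsto (fun n : ℕ => ∫ u : ℝ,
        ((b u * Real.exp (-((1 / ((n : ℝ) + 1)) * u)) : ℝ) : ℂ) * 𝓕 φ (u - y)) atTop
        (𝓝 (∫ u : ℝ, (b u : ℂ) * 𝓕 φ (u - y))) := by
      refine tendsto_integral_of_dominated_convergence (fun u => C * ‖𝓕 φ (u - y)‖) ?_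
        (hshift.norm.const_mul C) ?_ ?_
      · intro n
        exact (by fun_prop : Measurable fun u : ℝ =>
          ((b u * Real.exp (-((1 / ((n : ℝ) + 1)) * u)) : ℝ) : ℂ)).aestronglyMeasurable.mul
          hshift.aestronglyMeasurable
      · refine fun n => Eventually.of_forall fun u => ?_
        rw [norm_mul]
        gcongr
        rw [Complex.norm_real, Real.norm_eq_abs, abs_mul, Real.abs_exp]
        by_cases hu : u ≤ 0
        · simpa [hb0 u hu] using hC
        · push Not at hu
          have : Real.exp (-((1 / ((n : ℝ) + 1)) * u)) ≤ 1 :=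
            Real.exp_le_one_iff.2 (neg_nonpos.2 (mul_nonneg (hpos n).le hu.le))
          calc _ ≤ C * 1 := by gcongr; exact hbC u
            _ = C := mul_one C
      · refine Eventually.of_forall fun u => Tendsto.mul_const _ ?_
        refine (Complex.continuous_ofReal.tendsto _).comp ?_
        have : Tendsto (fun n : ℕ => b u * Real.exp (-((1 / ((n : ℝ) + 1)) * u))) atTop
            (𝓝 (b u * Real.exp (-(0 * u)))) :=
          ((Real.continuous_exp.tendsto _).comp (hu.mul_const u).neg).const_mul _
        simpa using this
    obtain ⟨M, hM⟩ := ((isCompact_univ (X := Set.Icc (0:ℝ) 1)).prod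
      hφc.isCompact).exists_bound_of_continuousOn hcurve.continuousOn
    have L2 : Tendsto (fun n : ℕ => ∫ ξ : ℝ,
        G ((1 / ((n : ℝ) + 1) : ℝ) + 2 * Real.pi * Complex.I * ξ) *
          (φ ξ * Complex.exp (2 * Real.pi * y * ξ * Complex.I))) atTop
        (𝓝 (∫ ξ : ℝ, G (2 * Real.pi * Complex.I * ξ) *
          (φ ξ * Complex.exp (2 * Real.pi * y * ξ * Complex.I)))) := by
      refine tendsto_integral_of_dominated_convergence (fun ξ => M * ‖φ ξ‖) ?_
        (hφint.norm.const_mul M) ?_ ?_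
      · intro n
        have : Continuous fun ξ : ℝ => G ((1 / ((n : ℝ) + 1) : ℝ) + 2 * Real.pi * Complex.I * ξ) :=
          hcurve.comp (Continuous.prodMk_right (⟨1 / ((n : ℝ) + 1), (hpos n).le, hle n⟩ : Set.Icc (0:ℝ) 1))
        exact (this.mul (hφ.mul (by fun_prop))).aestronglyMeasurable
      · refine fun n => Eventually.of_forall fun ξ => ?_
        rw [norm_mul, norm_mul, show (2 * Real.pi * y * ξ * Complex.I : ℂ) =
          ((2 * Real.pi * y * ξ : ℝ) : ℂ) * Complex.I by push_cast; ring,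
          Complex.norm_exp_ofReal_mul_I, mul_one]
        by_cases hξ : ξ ∈ tsupport φ
        · gcongr
          exact hM (⟨1 / ((n : ℝ) + 1), (hpos n).le, hle n⟩, ξ) ⟨Set.mem_univ _, hξ⟩
        · simp [image_eq_zero_of_notMem_tsupport hξ]
      · refine Eventually.of_forall fun ξ => Tendsto.mul_const _ ?_
        have h1 : Continuous fun δ : Set.Icc (0:ℝ) 1 =>
          G ((δ : ℝ) + 2 * Real.pi * Complex.I * ξ) := hcurve.comp (Continuous.prodMk_left ξ)
        have h2 := (h1.tendsto ⟨0, by simp⟩).comp (f := fun n : ℕ =>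
          (⟨1 / ((n : ℝ) + 1), (hpos n).le, hle n⟩ : Set.Icc (0:ℝ) 1)) (x := atTop)
          (tendsto_subtype_rng.2 hu)
        simpa [Function.comp_def] using h2
    rw [tendsto_nhds_unique L1 (L2.congr fun n => (hδ _ (hpos n)).symm),
      Real.fourier_real_eq_integral_exp_smul]
    congr 1
    ext ξ
    rw [smul_eq_mul, mul_comm (Complex.exp _), mul_assoc (G _)]
    congr 4
    push_cast
    ring
  simp_rw [key]
  refine (Real.zero_at_infty_fourier _).comp ?_
  exact tendsto_neg_atTop_atBot.mono_right (by rw [cocompact_eq_atBot_atTop]; exact le_sup_left)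

open MeasureTheory FourierTransform in
theorem exists_nonneg_kernel_with_compactly_supported_fourier :
    ∃ (φ : ℝ → ℂ) (F : ℝ → ℝ), Continuous φ ∧ HasCompactSupport φ ∧ (∀ v, 𝓕 φ v = F v) ∧
      (∀ v, 0 ≤ F v) ∧ Integrable F ∧ ∫ v, F v = 1 := by
  let χ : ContDiffBump (0 : ℝ) := ⟨1, 2, one_pos, one_lt_two⟩
  let χc : ℝ → ℂ := fun x => (χ x : ℂ)
  have hχs : HasCompactSupport χc := χ.hasCompactSupport.comp_left Complex.ofReal_zero
  have hχd : ContDiff ℝ (⊤ : ℕ∞) χc := Complex.ofRealCLM.contDiff.comp χ.contDiff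
  have hχc : Continuous χc := hχd.continuous
  have hχi : Integrable χc := hχc.integrable_of_hasCompactSupport hχs
  let g : SchwartzMap ℝ ℂ := 𝓕 (hχs.toSchwartzMap hχd)
  have hg : ∀ v, g v = 𝓕 χc v := fun v => by
    simp only [g, SchwartzMap.fourier_coe]
    rfl
  have hreal : ∀ v, ((g v).re : ℂ) = g v := by
    intro v
    rw [← Complex.conj_eq_iff_re, hg, Real.fourier_real_eq_integral_exp_smul, ← integral_conj,
      ← integral_neg_eq_self]
    congr 1
    ext x
    simp only [smul_eq_mul, map_mul, χc, χ.neg, Complex.conj_ofReal, ← Complex.exp_conj,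
      Complex.conj_I]
    congr 2
    push_cast
    ring
  have hgi : Integrable fun v => (g v).re ^ 2 := by
    have h1 : Integrable fun v => g v * g v :=
      g.integrable.bdd_mul (c := ‖g.toBoundedContinuousFunction‖)
        g.continuous.aestronglyMeasurable
        (Eventually.of_forall fun v => g.toBoundedContinuousFunction.norm_coe_le_norm v)
    refine h1.re.congr (Eventually.of_forall fun v => ?_)
    simp only
    rw [← hreal v]
    simp [sq]
  have hpos : 0 < ∫ v, (g v).re ^ 2 := by
    have hcont : Continuous fun v => (g v).re ^ 2 :=
      (Complex.continuous_re.comp g.continuous).pow 2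
    refine integral_pos_of_integrable_nonneg_nonzero (x := 0) hcont hgi
      (fun v => sq_nonneg _) ?_
    have : g 0 = ((∫ x, χ x : ℝ) : ℂ) := by
      rw [hg, Real.fourier_real_eq_integral_exp_smul]
      simpa [χc] using integral_complex_ofReal (f := fun x => χ x)
    rw [this, Complex.ofReal_re]
    exact pow_ne_zero _ χ.integral_pos.ne'
  set c := ∫ v, (g v).re ^ 2
  have hconv := Real.fourier_mul_convolution_eq hχi hχi
  have hcc : Continuous (convolution χc χc (ContinuousLinearMap.mul ℂ ℂ) volume) :=
    hχs.continuous_convolution_right _ hχi.locallyIntegrable hχc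
  have hcs : HasCompactSupport (convolution χc χc (ContinuousLinearMap.mul ℂ ℂ) volume) :=
    hχs.convolution _ hχs
  generalize convolution χc χc (ContinuousLinearMap.mul ℂ ℂ) volume = φ at hconv hcc hcs
  refine ⟨(c⁻¹ : ℂ) • φ,
    fun v => c⁻¹ * (g v).re ^ 2, ?_, ?_, ?_, ?_, hgi.const_mul _, ?_⟩
  · exact hcc.const_smul _
  · exact hcs.smul_left (f := fun _ => (c⁻¹ : ℂ))
  · intro v
    have : 𝓕 ((c⁻¹ : ℂ) • φ) v = (c⁻¹ : ℂ) • 𝓕 φ v := by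
      rw [Real.fourier_real_eq_integral_exp_smul, Real.fourier_real_eq_integral_exp_smul,
        ← integral_smul]
      congr 1
      ext x
      rw [Pi.smul_apply, smul_comm]
    rw [this, hconv, ← hg, ← hreal]
    simp [sq]
  · intro v; positivity
  · rw [integral_const_mul]
    exact inv_mul_cancel₀ hpos.ne'

open MeasureTheory FourierTransform in
theorem tendsto_one_of_laplace_continuous {B : ℝ → ℝ} {C : ℝ}
    (hmono : Monotone fun u => Real.exp u * B u) (hB0 : ∀ u, 0 ≤ B u) (hBC : ∀ u, B u ≤ C)
    (hBneg : ∀ u ≤ 0, B u = 0) {G : ℂ → ℂ} (hG : ContinuousOn G {s | 0 ≤ s.re})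
    (hBG : ∀ s : ℂ, 0 < s.re →
      ∫ u in Set.Ioi (0 : ℝ), ((B u - 1 : ℝ) : ℂ) * Complex.exp (-(s * u)) = G s) :
    Tendsto B atTop (𝓝 1) := by
  obtain ⟨φ, F, hφ, hφc, hφF, hF0, hFi, hF1⟩ :=
    exists_nonneg_kernel_with_compactly_supported_fourier
  have hC : 0 ≤ C := (hB0 0).trans (hBC 0)
  have hBm : Measurable B := by
    have : B = fun u => Real.exp (-u) * (Real.exp u * B u) := by
      ext u
      rw [← mul_assoc, ← Real.exp_add]
      simp
    rw [this]
    exact (by fun_prop : Measurable fun u : ℝ => Real.exp (-u)).mul hmono.measurable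
  let b : ℝ → ℝ := (Set.Ioi 0).indicator fun u => B u - 1
  have hb_eq : ∀ u, b u = B u - (Set.Ioi (0 : ℝ)).indicator 1 u := fun u => by
    by_cases hu : 0 < u
    · simp [b, hu]
    · simp [b, hu, hBneg u (not_lt.1 hu)]
  have hbG : ∀ s : ℂ, 0 < s.re → ∫ u : ℝ, (b u : ℂ) * Complex.exp (-(s * u)) = G s := by
    intro s hs
    rw [← hBG s hs, ← integral_indicator measurableSet_Ioi]
    congr 1
    ext u
    by_cases hu : 0 < u <;> simp [b, hu]
  have hbm : Measurable b := (hBm.sub_const 1).indicator measurableSet_Ioi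
  have hbC : ∀ u, |b u| ≤ C + 1 := by
    intro u
    by_cases hu : 0 < u
    · simp only [b, Set.indicator_of_mem (Set.mem_Ioi.2 hu), abs_le]
      constructor <;> linarith [hB0 u, hBC u]
    · simp only [b, Set.indicator_of_notMem (show u ∉ Set.Ioi 0 by simpa using hu), abs_zero]
      positivity
  have hcomp_int : ∀ (r y : ℝ), Integrable fun v => B (y + r * v) * F v := by
    intro r y
    refine hFi.bdd_mul (c := C) (hBm.comp (by fun_prop)).aestronglyMeasurable
      (Eventually.of_forall fun v => ?_)
    rw [Real.norm_eq_abs, abs_of_nonneg (hB0 _)]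
    exact hBC _
  have hind_int : ∀ (r y : ℝ),
      Integrable fun v => (Set.Ioi (0 : ℝ)).indicator 1 (y + r * v) * F v := by
    intro r y
    refine hFi.bdd_mul (c := 1) ((measurable_one.indicator measurableSet_Ioi).comp
      (by fun_prop)).aestronglyMeasurable (Eventually.of_forall fun v => ?_)
    by_cases h : 0 < y + r * v <;> simp [h]
  have hJ : ∀ r : ℝ, 0 < r → Tendsto (fun y => ∫ v, B (y + r * v) * F v) atTop (𝓝 1) := by
    intro r hr
    have hfour : 𝓕 (fun ξ => φ (r * ξ)) = fun w => ((r⁻¹ * F (r⁻¹ * w) : ℝ) : ℂ) := by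
      ext w
      have := Measure.integral_comp_mul_left
        (fun ξ : ℝ => Complex.exp (↑(-2 * Real.pi * ξ * (r⁻¹ * w)) * Complex.I) • φ ξ) r
      rw [← Real.fourier_real_eq_integral_exp_smul, hφF, abs_of_pos (by positivity)] at this
      rw [Real.fourier_real_eq_integral_exp_smul]
      rw [Complex.real_smul, ← Complex.ofReal_mul] at this
      rw [← this]
      congr 1
      ext ξ
      congr 4
      field_simp
    have h0 := tendsto_integral_mul_fourier_sub_of_laplace_continuous hbm hbC
      (fun u hu => by simp [b, hu]) hG hbG (φ := fun ξ => φ (r * ξ)) (by fun_prop)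
      (hφc.comp_homeomorph (Homeomorph.mulLeft₀ r hr.ne')) (by
        rw [hfour]
        exact ((hFi.comp_mul_left' (inv_ne_zero hr.ne')).const_mul _).ofReal)
    rw [hfour] at h0
    have h0' : Tendsto (fun y => ∫ v, b (y + r * v) * F v) atTop (𝓝 0) := by
      have hre := (Complex.continuous_re.tendsto _).comp h0
      refine hre.congr fun y => ?_
      simp only [Function.comp_apply]
      rw [show (∫ u : ℝ, (b u : ℂ) * ((r⁻¹ * F (r⁻¹ * (u - y)) : ℝ) : ℂ)) =
        ((∫ u : ℝ, b u * (r⁻¹ * F (r⁻¹ * (u - y))) : ℝ) : ℂ) by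
          rw [← integral_complex_ofReal]; simp only [Complex.ofReal_mul], Complex.ofReal_re,
        ← integral_add_right_eq_self _ y]
      have := Measure.integral_comp_mul_left
        (fun u => b (u + y) * (r⁻¹ * F (r⁻¹ * (u + y - y)))) r
      rw [abs_of_pos (by positivity), smul_eq_mul, inv_mul_eq_div, eq_div_iff hr.ne'] at this
      rw [← this, ← integral_mul_const]
      congr 1
      ext v
      rw [add_sub_cancel_right, inv_mul_cancel_left₀ hr.ne', add_comm]
      field_simp
    have h1 : Tendsto (fun y : ℝ => ∫ v, (Set.Ioi (0 : ℝ)).indicator 1 (y + r * v) * F v) atTop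
        (𝓝 (∫ v, F v)) := by
      refine tendsto_integral_filter_of_dominated_convergence F
        (Eventually.of_forall fun y => (hind_int r y).aestronglyMeasurable)
        (Eventually.of_forall fun y => Eventually.of_forall fun v => ?_) hFi
        (Eventually.of_forall fun v => ?_)
      · by_cases h : 0 < y + r * v <;> simp [h, abs_of_nonneg, hF0 v]
      · refine tendsto_const_nhds.congr' ?_
        filter_upwards [eventually_gt_atTop (-(r * v))] with y hy
        simp [show 0 < y + r * v by linarith]
    rw [← hF1, ← zero_add (∫ v, F v)]
    refine (h0'.add h1).congr fun y => ?_
    rw [← integral_add _ (hind_int r y)]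
    · congr 1
      ext v
      rw [hb_eq]
      ring
    · have := (hcomp_int r y).sub (hind_int r y)
      refine this.congr (Eventually.of_forall fun v => ?_)
      simp only [hb_eq, Pi.sub_apply]
      ring
  let I : ℕ → ℝ := fun n => ∫ v in (-(n : ℝ))..n, F v
  have hI : Tendsto I atTop (𝓝 1) := by
    rw [← hF1]
    exact intervalIntegral_tendsto_integral hFi
      (tendsto_neg_atTop_atBot.comp tendsto_natCast_atTop_atTop) tendsto_natCast_atTop_atTop
  have hI_set : ∀ n, I n = ∫ v in Set.Ioc (-(n : ℝ)) n, F v := fun n =>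
    intervalIntegral.integral_of_le (by linarith [n.cast_nonneg (α := ℝ)])
  have hI0 : ∀ n, 0 ≤ I n := fun n => by
    rw [hI_set]; exact integral_nonneg hF0
  have hI1 : ∀ n, I n ≤ 1 := fun n => by
    rw [hI_set, ← hF1]; exact setIntegral_le_integral hFi (Eventually.of_forall hF0)
  have hcmp : ∀ s t : ℝ, s ≤ t → B s ≤ Real.exp (t - s) * B t := by
    intro s t hst
    have := hmono hst
    simp only at this
    rw [Real.exp_sub, div_mul_eq_mul_div, le_div_iff₀ (Real.exp_pos _), mul_comm]
    exact this
  have hwin : ∀ n : ℕ, 0 < n → ∀ v ∈ Set.Ioc (-(n : ℝ)) n,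
      -(1 / (n : ℝ)) ≤ 1 / (n : ℝ) ^ 2 * v ∧ 1 / (n : ℝ) ^ 2 * v ≤ 1 / n := by
    intro n hn v hv
    have hn' : (0 : ℝ) < n := Nat.cast_pos.2 hn
    rw [show (1 / (n : ℝ)) = 1 / (n : ℝ) ^ 2 * n by field_simp, ← mul_neg]
    exact ⟨by gcongr; exact hv.1.le, by gcongr; exact hv.2⟩
  have hupper : ∀ n : ℕ, 0 < n → ∀ y : ℝ,
      Real.exp (-(2 / n)) * B (y - 1 / n) * I n ≤ ∫ v, B (y + 1 / (n : ℝ) ^ 2 * v) * F v := by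
    intro n hn y
    refine le_trans ?_ (setIntegral_le_integral (s := Set.Ioc (-(n : ℝ)) n) (hcomp_int _ y)
      (Eventually.of_forall fun v => mul_nonneg (hB0 _) (hF0 v)))
    rw [hI_set, ← integral_const_mul]
    refine setIntegral_mono_on (hFi.const_mul _).integrableOn (hcomp_int _ y).integrableOn
      measurableSet_Ioc fun v hv => ?_
    obtain ⟨h1, h2⟩ := hwin n hn v hv
    refine mul_le_mul_of_nonneg_right ?_ (hF0 v)
    rw [Real.exp_neg, inv_mul_le_iff₀ (Real.exp_pos _)]
    refine (hcmp (y - 1 / n) (y + 1 / (n : ℝ) ^ 2 * v) (by linarith)).trans ?_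
    refine mul_le_mul_of_nonneg_right (Real.exp_le_exp.2 ?_) (hB0 _)
    rw [show (2 : ℝ) / n = 1 / n + 1 / n by ring]
    linarith
  have hlower : ∀ n : ℕ, 0 < n → ∀ y : ℝ, ∫ v, B (y + 1 / (n : ℝ) ^ 2 * v) * F v ≤
      C * (1 - I n) + Real.exp (2 / n) * B (y + 1 / n) := by
    intro n hn y
    have hcompl : ∫ v in (Set.Ioc (-(n : ℝ)) n)ᶜ, F v = 1 - I n := by
      rw [hI_set, ← hF1, ← integral_add_compl (s := Set.Ioc (-(n : ℝ)) n) measurableSet_Ioc hFi]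
      ring
    rw [← integral_add_compl (s := Set.Ioc (-(n : ℝ)) n) measurableSet_Ioc (hcomp_int _ y),
      add_comm]
    refine add_le_add ?_ ?_
    · rw [← hcompl, ← integral_const_mul]
      exact setIntegral_mono (hcomp_int _ y).integrableOn (hFi.const_mul _).integrableOn
        fun v => mul_le_mul_of_nonneg_right (hBC _) (hF0 v)
    · calc _ ≤ ∫ v in Set.Ioc (-(n : ℝ)) n, Real.exp (2 / n) * B (y + 1 / n) * F v := by
            refine setIntegral_mono_on (hcomp_int _ y).integrableOn (hFi.const_mul _).integrableOn
              measurableSet_Ioc fun v hv => ?_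
            obtain ⟨h1, h2⟩ := hwin n hn v hv
            refine mul_le_mul_of_nonneg_right ?_ (hF0 v)
            refine (hcmp (y + 1 / (n : ℝ) ^ 2 * v) (y + 1 / n) (by linarith)).trans ?_
            refine mul_le_mul_of_nonneg_right (Real.exp_le_exp.2 ?_) (hB0 _)
            rw [show (2 : ℝ) / n = 1 / n + 1 / n by ring]
            linarith
        _ = Real.exp (2 / n) * B (y + 1 / n) * I n := by rw [integral_const_mul, hI_set]
        _ ≤ _ := mul_le_of_le_one_right (mul_nonneg (Real.exp_pos _).le (hB0 _)) (hI1 n)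
  have hinv : Tendsto (fun n : ℕ => 1 / (n : ℝ)) atTop (𝓝 0) := tendsto_one_div_atTop_nhds_zero_nat
  have hexp : Tendsto (fun n : ℕ => Real.exp (2 / n)) atTop (𝓝 1) := by
    have : Tendsto (fun n : ℕ => (2 : ℝ) / n) atTop (𝓝 0) := tendsto_const_div_atTop_nhds_zero_nat 2
    simpa [Function.comp_def] using (Real.continuous_exp.tendsto 0).comp this
  refine tendsto_order.2 ⟨fun a ha => ?_, fun a ha => ?_⟩
  · have hlim : Tendsto (fun n : ℕ => C * (1 - I n) + Real.exp (2 / n) * a + 1 / n) atTop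
        (𝓝 (C * (1 - 1) + 1 * a + 0)) :=
      (((tendsto_const_nhds.sub hI).const_mul C).add (hexp.mul_const a)).add hinv
    obtain ⟨n, hn, hn0⟩ := ((hlim.eventually_lt_const (u := 1) (by simpa using ha)).and
      (eventually_gt_atTop 0)).exists
    have hn' : (0 : ℝ) < n := Nat.cast_pos.2 hn0
    have hev := (hJ (1 / (n : ℝ) ^ 2) (by positivity)).eventually_const_lt
      (u := 1 - 1 / (n : ℝ)) (by linarith [show 0 < 1 / (n : ℝ) by positivity])
    filter_upwards [(tendsto_atTop_add_const_right atTop (-(1 / (n : ℝ))) tendsto_id).eventually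
      hev] with y hy
    have h1 := hlower n hn0 (y + -(1 / (n : ℝ)))
    rw [neg_add_cancel_right] at h1
    simp only [id] at hy
    have : Real.exp (2 / n) * a < Real.exp (2 / n) * B y := by linarith
    exact lt_of_mul_lt_mul_left this (Real.exp_pos _).le
  · have hlim : Tendsto (fun n : ℕ => 1 + 1 / (n : ℝ) - (Real.exp (2 / n))⁻¹ * a * I n) atTop
        (𝓝 (1 + 0 - 1⁻¹ * a * 1)) :=
      (tendsto_const_nhds.add hinv).sub (((hexp.inv₀ one_ne_zero).mul_const a).mul hI)
    obtain ⟨n, hn, hn0⟩ := ((hlim.eventually_lt_const (u := 0) (by simpa using ha)).and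
      (eventually_gt_atTop 0)).exists
    have hn' : (0 : ℝ) < n := Nat.cast_pos.2 hn0
    have hev := (hJ (1 / (n : ℝ) ^ 2) (by positivity)).eventually_lt_const
      (u := 1 + 1 / (n : ℝ)) (by linarith [show 0 < 1 / (n : ℝ) by positivity])
    filter_upwards [(tendsto_atTop_add_const_right atTop (1 / (n : ℝ)) tendsto_id).eventually
      hev] with y hy
    have h1 := hupper n hn0 (y + 1 / (n : ℝ))
    rw [add_sub_cancel_right, Real.exp_neg] at h1
    simp only [id] at hy
    by_contra! hcon
    have : (Real.exp (2 / n))⁻¹ * a * I n ≤ (Real.exp (2 / n))⁻¹ * B y * I n := by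
      have := hI0 n
      gcongr
    linarith

open MeasureTheory Chebyshev in
theorem integral_psi_mul_cpow_eq {s : ℂ} (hs : 0 < s.re) :
    ∫ t in Set.Ioi (1 : ℝ), (psi t : ℂ) * (t : ℂ) ^ (-(s + 2)) =
      (ArithmeticFunction.vonMangoldt.LFunctionResidueClassAux (1 : ZMod 1) (s + 1) + 1 / s) /
        (s + 1) := by
  have hs1 : s + 1 ≠ 0 := fun h => by
    have := congrArg Complex.re h
    simp at this
    linarith
  have hΛ : ArithmeticFunction.vonMangoldt.residueClass (1 : ZMod 1) =
      ArithmeticFunction.vonMangoldt := by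
    ext n
    simp [ArithmeticFunction.vonMangoldt.residueClass, Set.indicator, Subsingleton.elim _ (1 : ZMod 1)]
  have haux := ArithmeticFunction.vonMangoldt.eqOn_LFunctionResidueClassAux
    (isUnit_one (M := ZMod 1)) (show (s + 1) ∈ {s : ℂ | 1 < s.re} by simpa using hs)
  simp only [hΛ, Nat.totient_one, Nat.cast_one, inv_one, add_sub_cancel_right] at haux
  rw [haux, sub_add_cancel, LSeries_eq_mul_integral_of_nonneg
    (fun n => ArithmeticFunction.vonMangoldt n) zero_le_one (by simpa using hs) ?_
    (fun _ => ArithmeticFunction.vonMangoldt_nonneg), mul_div_cancel_left₀ _ hs1]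
  · congr 1
    ext t
    congr 1
    · rw [psi, ← Finset.Icc_add_one_left_eq_Ioc]
      push_cast
      rfl
    · congr 1
      ring
  · refine Asymptotics.IsBigO.of_bound (Real.log 4 + 4) (Eventually.of_forall fun n => ?_)
    have h := psi_le_const_mul_self (n.cast_nonneg (α := ℝ))
    rw [psi, Nat.floor_natCast, ← Finset.Icc_add_one_left_eq_Ioc] at h
    rw [Real.rpow_one, Real.norm_natCast, Real.norm_eq_abs, abs_of_nonneg
      (Finset.sum_nonneg fun _ _ => ArithmeticFunction.vonMangoldt_nonneg)]
    exact h

open MeasureTheory Chebyshev in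
theorem tendsto_psi_div_atTop : Tendsto (fun x : ℝ => psi x / x) atTop (𝓝 1) := by
  let A := ArithmeticFunction.vonMangoldt.LFunctionResidueClassAux (1 : ZMod 1)
  have hmain : Tendsto (fun u : ℝ => psi (Real.exp u) / Real.exp u) atTop (𝓝 1) := by
    refine tendsto_one_of_laplace_continuous (C := Real.log 4 + 4)
      (G := fun s => (A (s + 1) - 1) / (s + 1)) ?_ ?_ ?_ ?_ ?_ ?_
    · intro u v huv
      simp only [mul_div_cancel₀ _ (Real.exp_ne_zero _)]
      exact psi_mono (Real.exp_le_exp.2 huv)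
    · exact fun u => div_nonneg (psi_nonneg _) (Real.exp_pos _).le
    · exact fun u => (div_le_iff₀ (Real.exp_pos _)).2 (psi_le_const_mul_self (Real.exp_pos _).le)
    · intro u hu
      rw [psi_eq_zero_of_le_one (Real.exp_le_one_iff.2 hu), zero_div]
    · refine ContinuousOn.div (ContinuousOn.sub ?_ continuousOn_const)
        (by fun_prop) fun s hs h => ?_
      · refine (ArithmeticFunction.vonMangoldt.continuousOn_LFunctionResidueClassAux
          (1 : ZMod 1)).comp (by fun_prop) fun s hs => ?_
        simpa using hs
      · have := congrArg Complex.re h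
        simp at this hs
        linarith
    · intro s hs
      have hs1 : s + 1 ≠ 0 := fun h => by
        have := congrArg Complex.re h
        simp at this
        linarith
      have hs0 : s ≠ 0 := fun h => by simp [h] at hs
      have himg : Real.exp '' Set.Ioi 0 = Set.Ioi 1 := by
        ext x
        constructor
        · rintro ⟨u, hu, rfl⟩
          exact Real.one_lt_exp_iff.2 hu
        · intro hx
          exact ⟨Real.log x, Real.log_pos hx, Real.exp_log (one_pos.trans hx)⟩
      have hint1 : IntegrableOn (fun t : ℝ => (t : ℂ) ^ (-(s + 1))) (Set.Ioi 1) :=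
        integrableOn_Ioi_cpow_of_lt (by simpa using hs) one_pos
      have hint2 : IntegrableOn (fun t : ℝ => (psi t : ℂ) * (t : ℂ) ^ (-(s + 2))) (Set.Ioi 1) := by
        have hm : AEStronglyMeasurable (fun t : ℝ => (psi t : ℂ) * (t : ℂ) ^ (-(s + 2)))
            (volume.restrict (Set.Ioi 1)) := by
          refine (Complex.measurable_ofReal.comp psi_mono.measurable).aestronglyMeasurable.mul ?_
          refine ContinuousOn.aestronglyMeasurable (fun t ht => ?_) measurableSet_Ioi
          exact (Complex.continuousAt_ofReal_cpow_const _ _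
            (Or.inr (one_pos.trans ht).ne')).continuousWithinAt
        refine (hint1.norm.const_mul (Real.log 4 + 4)).mono' hm ?_
        refine (ae_restrict_iff' measurableSet_Ioi).2 (Eventually.of_forall fun t ht => ?_)
        have ht0 : (0 : ℝ) < t := one_pos.trans ht
        rw [norm_mul, Complex.norm_cpow_eq_rpow_re_of_pos ht0, Complex.norm_real,
          Complex.norm_cpow_eq_rpow_re_of_pos ht0, Real.norm_eq_abs, abs_of_nonneg (psi_nonneg _)]
        calc _ ≤ ((Real.log 4 + 4) * t) * t ^ (-(s + 2)).re := by
              gcongr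
              exact psi_le_const_mul_self ht0.le
          _ = _ := by
              rw [mul_assoc, ← Real.rpow_one_add' ht0.le]
              · congr 2
                simp
                ring
              · simp
                linarith
      have hcv := integral_image_eq_integral_abs_deriv_smul (s := Set.Ioi (0 : ℝ))
        (f := Real.exp) (f' := Real.exp) measurableSet_Ioi
        (fun x _ => (Real.hasDerivAt_exp x).hasDerivWithinAt) Real.exp_injective.injOn
        (fun t => (psi t : ℂ) * (t : ℂ) ^ (-(s + 2)) - (t : ℂ) ^ (-(s + 1)))
      rw [himg, integral_sub hint2 hint1, integral_psi_mul_cpow_eq hs,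
        integral_Ioi_cpow_of_lt (by simpa using hs) one_pos] at hcv
      trans (A (s + 1) + 1 / s) / (s + 1) - -((1 : ℝ) : ℂ) ^ (-(s + 1) + 1) / (-(s + 1) + 1)
      · rw [hcv]
        refine setIntegral_congr_fun measurableSet_Ioi fun u hu => ?_
        have hcp : ∀ w : ℂ, ((Real.exp u : ℝ) : ℂ) ^ w = Complex.exp (u * w) := fun w => by
          rw [Complex.ofReal_exp, Complex.cpow_def_of_ne_zero (Complex.exp_ne_zero _),
            ← Complex.ofReal_exp,
            ← Complex.ofReal_log (Real.exp_pos _).le, Real.log_exp]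
        simp only [hcp, Complex.real_smul, abs_of_pos (Real.exp_pos _)]
        push_cast
        rw [show (u : ℂ) * -(s + 2) = -(s * u) + -(u + u) by ring,
          show (u : ℂ) * -(s + 1) = -(s * u) + -u by ring, Complex.exp_add, Complex.exp_add,
          Complex.exp_neg (u + u), Complex.exp_neg (u : ℂ), Complex.exp_add]
        have := Complex.exp_ne_zero u
        field_simp
      · simp only [Complex.ofReal_one, Complex.one_cpow]
        rw [show -(s + 1) + 1 = -s by ring]
        simp only [A]
        field_simp
        ring
  refine (hmain.comp Real.tendsto_log_atTop).congr' ?_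
  filter_upwards [eventually_gt_atTop 0] with x hx
  simp [Real.exp_log hx]

open Chebyshev in
theorem tendsto_theta_div_atTop : Tendsto (fun x : ℝ => theta x / x) atTop (𝓝 1) := by
  have h1 : (fun x : ℝ => √x) =o[atTop] (fun x : ℝ => x) := by
    refine (Asymptotics.isLittleO_iff_tendsto' ?_).2 ?_
    · filter_upwards [eventually_gt_atTop 0] with x hx h
      exact absurd h hx.ne'
    · simp_rw [Real.sqrt_div_self']
      exact (tendsto_const_nhds (x := (1 : ℝ))).div_atTop Real.tendsto_sqrt_atTop
  have h2 := (isBigO_psi_sub_theta_sqrt.trans_isLittleO h1).tendsto_div_nhds_zero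
  have h3 := tendsto_psi_div_atTop.sub h2
  rw [sub_zero] at h3
  refine h3.congr fun x => ?_
  simp only [Pi.sub_apply]
  ring

theorem tendsto_primeCounting_mul_log_div_atTop :
    Tendsto (fun x : ℝ => (Nat.primeCounting ⌊x⌋₊ : ℝ) * Real.log x / x) atTop (𝓝 1) := by
  have h1 : (fun x : ℝ => x / Real.log x ^ 2) =o[atTop] (fun x : ℝ => x / Real.log x) := by
    refine (Asymptotics.isLittleO_iff_tendsto' ?_).2 ?_
    · filter_upwards [eventually_gt_atTop 1] with x hx h
      have := Real.log_pos hx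
      exact absurd h (by positivity)
    · refine Real.tendsto_log_atTop.inv_tendsto_atTop.congr' ?_
      filter_upwards [eventually_gt_atTop 1] with x hx
      have := Real.log_pos hx
      simp only [Pi.inv_apply]
      field_simp
  have h2 := (Chebyshev.primeCounting_sub_theta_div_log_isBigO.trans_isLittleO
    h1).tendsto_div_nhds_zero
  have h3 := tendsto_theta_div_atTop.add h2
  rw [add_zero] at h3
  refine h3.congr' ?_
  filter_upwards [eventually_gt_atTop 1] with x hx
  have := Real.log_pos hx
  field_simp
  ring

open MeasureTheory in
theorem hasSum_prime_exp_neg_mul {t : ℝ} (ht : 0 < t) :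
    HasSum (fun n : ℕ => if n.Prime then Real.exp (-(t * n)) else 0)
      (∫ y in Set.Ioi (0 : ℝ), (Nat.primeCounting ⌊y / t⌋₊ : ℝ) * Real.exp (-y)) := by
  set F : ℕ → ℝ → ℝ := fun n => if n.Prime then
    (Set.Ici (t * n)).indicator (fun y => Real.exp (-y)) else 0 with hF
  have hF_int : ∀ n, Integrable (F n) (volume.restrict (Set.Ioi 0)) := by
    intro n
    simp only [hF]
    split_ifs
    · exact (integrableOn_exp_neg_Ioi 0).indicator measurableSet_Ici
    · exact integrable_zero _ _ _
  have hval : ∀ n, ∫ y in Set.Ioi (0 : ℝ), F n y =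
      if n.Prime then Real.exp (-(t * n)) else 0 := by
    intro n
    simp only [hF]
    split_ifs with hn
    · have hpos : 0 < t * n := mul_pos ht (by exact_mod_cast hn.pos)
      rw [integral_indicator measurableSet_Ici, Measure.restrict_restrict measurableSet_Ici,
        Set.inter_eq_left.2 (Set.Ici_subset_Ioi.2 hpos), integral_Ici_eq_integral_Ioi,
        integral_exp_neg_Ioi]
    · simp
  have hnn : ∀ n y, 0 ≤ F n y := by
    intro n y
    simp only [hF]
    split_ifs
    · exact Set.indicator_nonneg (fun _ _ => (Real.exp_pos _).le) _
    · simp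
  have hsum : Summable fun n => ∫ y in Set.Ioi (0 : ℝ), ‖F n y‖ := by
    simp_rw [Real.norm_of_nonneg (hnn _ _), hval]
    refine Summable.of_nonneg_of_le (fun n => ?_) (fun n => ?_)
      (Real.summable_exp_nat_mul_of_ge (c := -t) (by linarith) (f := fun n => n) fun n => le_rfl)
    · split_ifs <;> positivity
    · split_ifs
      · apply Real.exp_le_exp.2; linarith
      · positivity
  have key := hasSum_integral_of_summable_integral_norm hF_int hsum
  simp_rw [hval] at key
  rw [show ∫ y in Set.Ioi (0 : ℝ), (Nat.primeCounting ⌊y / t⌋₊ : ℝ) * Real.exp (-y) =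
    ∫ y in Set.Ioi (0 : ℝ), ∑' n, F n y from ?_]
  · exact key
  refine setIntegral_congr_fun measurableSet_Ioi fun y hy => ?_
  have hy0 : (0 : ℝ) < y := hy
  rw [tsum_eq_sum (s := (Finset.range (⌊y / t⌋₊ + 1)).filter Nat.Prime)]
  · rw [Finset.sum_congr rfl (g := fun _ => Real.exp (-y))]
    · rw [Finset.sum_const, nsmul_eq_mul, Nat.primeCounting, Nat.primeCounting',
        Nat.count_eq_card_filter_range]
    · intro n hn
      rw [Finset.mem_filter, Finset.mem_range, Nat.lt_succ_iff, Nat.le_floor_iff (by positivity),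
        le_div_iff₀ ht] at hn
      simp only [hF, hn.2, if_true]
      rw [Set.indicator_of_mem]
      rw [Set.mem_Ici]; linarith [hn.1]
  · intro n hn
    rw [Finset.mem_filter, Finset.mem_range, Nat.lt_succ_iff, Nat.le_floor_iff (by positivity),
        le_div_iff₀ ht, not_and] at hn
    simp only [hF]
    split_ifs with hp
    · rw [Set.indicator_of_notMem]
      rw [Set.mem_Ici]
      intro h
      exact hn (by linarith) hp
    · simp

theorem primeCounting_le_self (n : ℕ) : Nat.primeCounting n ≤ n := by
  rw [Nat.primeCounting, Nat.primeCounting', Nat.count_eq_card_filter_range]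
  calc _ ≤ (Finset.Ioc 0 n).card := Finset.card_le_card fun p hp => by
        rw [Finset.mem_filter, Finset.mem_range] at hp
        exact Finset.mem_Ioc.2 ⟨hp.2.pos, Nat.lt_succ_iff.1 hp.1⟩
    _ = n := by simp

theorem exists_primeCounting_mul_log_le :
    ∃ C : ℝ, 0 ≤ C ∧ ∀ x : ℝ, 1 ≤ x → (Nat.primeCounting ⌊x⌋₊ : ℝ) * Real.log x ≤ C * x := by
  obtain ⟨X, hX⟩ := eventually_atTop.1
    (tendsto_primeCounting_mul_log_div_atTop.eventually_le_const (by norm_num : (1 : ℝ) < 2))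
  refine ⟨max 2 (Real.log X), le_max_of_le_left (by norm_num), fun x hx => ?_⟩
  have hx0 : 0 < x := by linarith
  rcases le_total X x with h | h
  · have := hX x h
    rw [div_le_iff₀ hx0] at this
    exact this.trans (mul_le_mul_of_nonneg_right (le_max_left _ _) hx0.le)
  · have h1 : (Nat.primeCounting ⌊x⌋₊ : ℝ) ≤ x :=
      (Nat.cast_le.2 (primeCounting_le_self _)).trans (Nat.floor_le hx0.le)
    have h2 : Real.log x ≤ max 2 (Real.log X) :=
      (Real.log_le_log hx0 h).trans (le_max_right _ _)
    have := Real.log_nonneg hx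
    nlinarith [mul_le_mul h1 h2 this hx0.le]

open MeasureTheory in
theorem tendsto_mul_log_mul_integral_primeCounting :
    Tendsto (fun t : ℝ => t * -Real.log t *
      ∫ y in Set.Ioi (0 : ℝ), (Nat.primeCounting ⌊y / t⌋₊ : ℝ) * Real.exp (-y))
      (𝓝[>] 0) (𝓝 1) := by
  obtain ⟨C, hC0, hC⟩ := exists_primeCounting_mul_log_le
  have hΓ : ∫ y in Set.Ioi (0 : ℝ), y * Real.exp (-y) = 1 := by
    have h := Real.Gamma_eq_integral (s := 2) (by norm_num)
    rw [Real.Gamma_two] at h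
    rw [h]
    refine setIntegral_congr_fun measurableSet_Ioi fun y _ => ?_
    norm_num [mul_comm]
  have hsplit : ∀ t y : ℝ, 0 < t → 0 < y → t * -Real.log t * (Nat.primeCounting ⌊y / t⌋₊ : ℝ) =
      t * (Nat.primeCounting ⌊y / t⌋₊ * Real.log (y / t)) -
        t * Nat.primeCounting ⌊y / t⌋₊ * Real.log y := by
    intro t y ht hy
    rw [Real.log_div hy.ne' ht.ne']
    ring
  simp_rw [← integral_const_mul]
  rw [← hΓ]
  refine tendsto_integral_filter_of_dominated_convergence
    (fun y => (C * y + 1) * Real.exp (-y)) ?_ ?_ ?_ ?_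
  · refine Eventually.of_forall fun t => Measurable.aestronglyMeasurable ?_
    have h1 : Measurable fun y : ℝ => (Nat.primeCounting ⌊y / t⌋₊ : ℝ) :=
      (Measurable.of_discrete (f := fun n : ℕ => (Nat.primeCounting n : ℝ))).comp
        (Nat.measurable_floor.comp (measurable_id.div_const t))
    fun_prop
  · filter_upwards [Ioo_mem_nhdsGT (zero_lt_one (α := ℝ))] with t ht
    filter_upwards [self_mem_ae_restrict measurableSet_Ioi] with y hy
    have hy0 : (0 : ℝ) < y := hy
    have ht0 := ht.1
    have hL : 0 ≤ -Real.log t := by linarith [Real.log_nonpos ht.1.le ht.2.le]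
    rw [← mul_assoc, Real.norm_of_nonneg (by positivity)]
    refine mul_le_mul_of_nonneg_right ?_ (Real.exp_pos _).le
    rcases lt_or_ge (y / t) 1 with h | h
    · rw [Nat.floor_eq_zero.2 h]
      simp only [Nat.primeCounting_zero, Nat.cast_zero, mul_zero]
      positivity
    · rw [hsplit t y ht0 hy0]
      have h1 := mul_le_mul_of_nonneg_left (hC _ h) ht0.le
      have h2 : t * (C * (y / t)) = C * y := by field_simp
      have h3 : (Nat.primeCounting ⌊y / t⌋₊ : ℝ) ≤ y / t :=
        (Nat.cast_le.2 (primeCounting_le_self _)).trans (Nat.floor_le (by linarith))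
      have h4 : t * (Nat.primeCounting ⌊y / t⌋₊ : ℝ) ≤ y := by
        rw [le_div_iff₀ ht0] at h3; linarith
      have h5 : -Real.log y ≤ y⁻¹ := by
        have := Real.log_le_sub_one_of_pos (inv_pos.2 hy0)
        rw [Real.log_inv] at this
        linarith
      have h6 : t * (Nat.primeCounting ⌊y / t⌋₊ : ℝ) * -Real.log y ≤ y * y⁻¹ :=
        (mul_le_mul_of_nonneg_left h5 (by positivity)).trans
          (mul_le_mul_of_nonneg_right h4 (by positivity))
      rw [mul_inv_cancel₀ hy0.ne'] at h6
      linarith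
  · have h1 : IntegrableOn (fun y : ℝ => Real.exp (-y) * y) (Set.Ioi 0) := by
      have := Real.GammaIntegral_convergent (s := 2) (by norm_num)
      refine this.congr_fun (fun y _ => ?_) measurableSet_Ioi
      norm_num
    refine ((h1.const_mul C).add (integrableOn_exp_neg_Ioi 0)).congr
      (Eventually.of_forall fun y => ?_)
    simp only [Pi.add_apply]
    ring
  · filter_upwards [self_mem_ae_restrict measurableSet_Ioi] with y hy
    have hy0 : (0 : ℝ) < y := hy
    have hx : Tendsto (fun t : ℝ => y / t) (𝓝[>] 0) atTop := by
      simp_rw [div_eq_mul_inv]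
      exact tendsto_inv_nhdsGT_zero.const_mul_atTop hy0
    have h1 := tendsto_primeCounting_mul_log_div_atTop.comp hx
    have h2 := h1.mul (Real.tendsto_log_atTop.comp hx).inv_tendsto_atTop
    have h3 := ((h1.const_mul y).sub (h2.const_mul (y * Real.log y))).mul_const (Real.exp (-y))
    simp only [mul_one, mul_zero, sub_zero] at h3
    refine h3.congr' ?_
    filter_upwards [self_mem_nhdsWithin, hx.eventually_gt_atTop 1] with t ht hlt
    have ht0 : 0 < t := ht
    have hlog := Real.log_pos hlt
    rw [← mul_assoc (t * -Real.log t), hsplit t y ht0 hy0]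
    simp only [Function.comp, Pi.inv_apply]
    congr 1
    field_simp

theorem tendsto_one_sub_mul_log_mul_tsum_odd_prime :
    Tendsto (fun z : ℝ => (1 - z) * Real.log (1 / (1 - z)) *
      ∑' p : {p : ℕ // p.Prime ∧ Odd p}, z ^ (p : ℕ)) (𝓝[<] 1) (𝓝 1) := by
  have hsum : ∀ z : ℝ, z ∈ Set.Ioo (0 : ℝ) 1 → ∑' p : {p : ℕ // p.Prime ∧ Odd p}, z ^ (p : ℕ) =
      (∫ y in Set.Ioi (0 : ℝ), (Nat.primeCounting ⌊y / -Real.log z⌋₊ : ℝ) * Real.exp (-y)) -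
        z ^ 2 := by
    intro z hz
    have h1 := hasSum_prime_exp_neg_mul (neg_pos.2 (Real.log_neg hz.1 hz.2))
    have h2 := h1.sub (hasSum_ite_eq 2 (z ^ 2))
    rw [← h2.tsum_eq]
    refine (tsum_subtype {p : ℕ | p.Prime ∧ Odd p} fun p => z ^ p).trans ?_
    refine tsum_congr fun n => ?_
    have hexp : Real.exp (-(-Real.log z * n)) = z ^ n := by
      rw [neg_mul, neg_neg, mul_comm, Real.exp_nat_mul, Real.exp_log hz.1]
    rw [hexp, Set.indicator_apply]
    simp only [Set.mem_ofPred_eq]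
    by_cases hn : n.Prime
    · rcases hn.eq_two_or_odd' with rfl | hodd
      · simp [hn]
      · have h2 : n ≠ 2 := by rintro rfl; exact absurd hodd (by decide)
        simp [hn, hodd, h2]
    · have h2 : n ≠ 2 := by rintro rfl; exact hn Nat.prime_two
      simp [hn, h2]
  have ht : Tendsto (fun z : ℝ => -Real.log z) (𝓝[<] 1) (𝓝[>] 0) := by
    refine tendsto_nhdsWithin_iff.2 ⟨?_, ?_⟩
    · have := (Real.continuousAt_log one_ne_zero).neg.tendsto
      rw [Pi.neg_apply, Real.log_one, neg_zero] at this
      exact this.mono_left nhdsWithin_le_nhds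
    · filter_upwards [Ioo_mem_nhdsLT (zero_lt_one (α := ℝ))] with z hz
      exact neg_pos.2 (Real.log_neg hz.1 hz.2)
  have hρ : Tendsto (fun z : ℝ => (1 - z) / -Real.log z) (𝓝[<] 1) (𝓝 1) := by
    have h := hasDerivAt_iff_tendsto_slope.1 (Real.hasDerivAt_log one_ne_zero)
    have h' := (h.mono_left (nhdsWithin_mono 1 fun z (hz : z < 1) => hz.ne)).inv₀ (by norm_num)
    simp only [inv_one] at h'
    refine h'.congr fun z => ?_
    rw [slope_def_field, Real.log_one, sub_zero, inv_div, div_neg, ← neg_div, neg_sub]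
  have hlog : Tendsto (fun z : ℝ => Real.log (-Real.log z)) (𝓝[<] 1) atBot :=
    Real.tendsto_log_nhdsGT_zero.comp ht
  have hlogρ := (Real.continuousAt_log one_ne_zero).tendsto.comp hρ
  rw [Real.log_one] at hlogρ
  have hcorr := (hlogρ.mul hlog.inv_tendsto_atBot).const_add 1
  have hA := tendsto_mul_log_mul_integral_primeCounting.comp ht
  have hB : Tendsto (fun z : ℝ => -Real.log z * -Real.log (-Real.log z) * z ^ 2)
      (𝓝[<] 1) (𝓝 0) := by
    have h0 : Tendsto (fun t : ℝ => t * -Real.log t) (𝓝[>] 0) (𝓝 0) := by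
      have := (Real.continuous_mul_log.tendsto 0).neg
      simp only [Real.log_zero, mul_zero, neg_zero] at this
      refine (this.mono_left nhdsWithin_le_nhds).congr fun t => ?_
      ring
    have h1 : Tendsto (fun z : ℝ => z ^ 2) (𝓝[<] 1) (𝓝 (1 ^ 2)) :=
      ((continuous_pow 2).tendsto 1).mono_left nhdsWithin_le_nhds
    simpa using (h0.comp ht).mul h1
  have key := (hρ.mul (hA.sub hB)).mul hcorr
  simp only [mul_zero, add_zero, sub_zero, mul_one] at key
  refine key.congr' ?_
  filter_upwards [Ioo_mem_nhdsLT (zero_lt_one (α := ℝ)), hlog.eventually_lt_atBot 0] with z hz hneg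
  have ht0 := neg_pos.2 (Real.log_neg hz.1 hz.2)
  have h1z : 0 < 1 - z := by linarith [hz.2]
  rw [hsum z hz, one_div, Real.log_inv]
  simp only [Function.comp, Pi.inv_apply]
  rw [Real.log_div h1z.ne' ht0.ne']
  have hne := hneg.ne
  generalize Real.log (-Real.log z) = L at *
  generalize Real.log (1 - z) = M at *
  generalize (∫ y in Set.Ioi (0 : ℝ),
    (Nat.primeCounting ⌊y / -Real.log z⌋₊ : ℝ) * Real.exp (-y)) = I at *
  generalize -Real.log z = t at *
  field_simp
  ring

theorem tendsto_tsum_odd_prime_pow_atTop :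
    Tendsto (fun z : ℝ => ∑' p : {p : ℕ // p.Prime ∧ Odd p}, z ^ (p : ℕ)) (𝓝[<] 1) atTop := by
  have h0 : Tendsto (fun z : ℝ => (1 - z) * Real.log (1 / (1 - z))) (𝓝[<] 1) (𝓝[>] 0) := by
    refine tendsto_nhdsWithin_iff.2 ⟨?_, ?_⟩
    · have h : Tendsto (fun z : ℝ => -((1 - z) * Real.log (1 - z))) (𝓝 1)
          (𝓝 (-((1 - 1) * Real.log (1 - 1)))) :=
        (Real.continuous_mul_log.comp (continuous_sub_left (1 : ℝ))).neg.tendsto 1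
      rw [sub_self, zero_mul, neg_zero] at h
      refine (h.mono_left nhdsWithin_le_nhds).congr fun z => ?_
      rw [one_div, Real.log_inv, mul_neg]
    · filter_upwards [Ioo_mem_nhdsLT (zero_lt_one (α := ℝ))] with z hz
      have h1 : 0 < 1 - z := by linarith [hz.2]
      exact mul_pos h1 (Real.log_pos (by rw [lt_div_iff₀ h1]; linarith [hz.1]))
  have := h0.inv_tendsto_nhdsGT_zero.atTop_mul_pos one_pos
    tendsto_one_sub_mul_log_mul_tsum_odd_prime
  refine this.congr' ?_
  filter_upwards [(tendsto_nhdsWithin_iff.1 h0).2] with z hz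
  have hne : (1 - z) * Real.log (1 / (1 - z)) ≠ 0 := ne_of_gt hz
  rw [Pi.inv_apply, inv_mul_cancel_left₀ hne]

open scoped ENNReal

/-- The complete homogeneous symmetric sum of degree `m` of the weights `w`. -/
noncomputable def tsumSym {α : Type*} (w : α → ℝ≥0∞) (m : ℕ) : ℝ≥0∞ :=
  ∑' s : Sym α m, ((s : Multiset α).map w).prod

theorem tsumSym_zero {α : Type*} (w : α → ℝ≥0∞) : tsumSym w 0 = 1 := by
  rw [tsumSym, tsum_eq_single default fun s hs => absurd (Subsingleton.elim s _) hs]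
  rw [Subsingleton.elim (default : Sym α 0) Sym.nil]
  simp

theorem tsumSym_one {α : Type*} (w : α → ℝ≥0∞) : tsumSym w 1 = ∑' a, w a := by
  rw [tsumSym, ← Sym.oneEquiv.tsum_eq]
  refine tsum_congr fun a => ?_
  change ((({a} : Multiset α)).map w).prod = w a
  simp

/-- A pointed symmetric power: an element together with `m` further ones is the same as a
multiset of size `m + 1` with a distinguished member. -/
def Sym.prodEquivSigmaMem (α : Type*) [DecidableEq α] (m : ℕ) :
    α × Sym α m ≃ Σ t : Sym α (m + 1), {a // a ∈ (t : Multiset α).toFinset} where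
  toFun p := ⟨p.1 ::ₛ p.2, p.1, by simp⟩
  invFun q := (q.2.1, q.1.erase q.2.1 (Multiset.mem_toFinset.1 q.2.2))
  left_inv p := by simp
  right_inv q := by
    obtain ⟨t, a, ha⟩ := q
    have h : a ::ₛ t.erase a (Multiset.mem_toFinset.1 ha) = t := Sym.cons_erase _
    refine Sigma.ext h ?_
    exact (Subtype.heq_iff_coe_eq (by intro x; simp only [h])).2 rfl

theorem tsum_mul_tsumSym {α : Type*} [DecidableEq α] (w : α → ℝ≥0∞) (m : ℕ) :
    (∑' a, w a) * tsumSym w m =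
      ∑' t : Sym α (m + 1), ((t : Multiset α).toFinset.card : ℝ≥0∞) *
        ((t : Multiset α).map w).prod := by
  have h1 : (∑' a, w a) * tsumSym w m = ∑' p : α × Sym α m,
      (((p.1 ::ₛ p.2 : Sym α (m + 1)) : Multiset α).map w).prod := by
    rw [ENNReal.tsum_prod', tsumSym, ← ENNReal.tsum_mul_right]
    refine tsum_congr fun a => ?_
    rw [← ENNReal.tsum_mul_left]
    refine tsum_congr fun s => ?_
    rw [Sym.coe_cons, Multiset.map_cons, Multiset.prod_cons]
  rw [h1, ← (Sym.prodEquivSigmaMem α m).symm.tsum_eq, ENNReal.tsum_sigma']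
  refine tsum_congr fun t => ?_
  rw [tsum_fintype, Finset.sum_congr rfl (g := fun _ => ((t : Multiset α).map w).prod)]
  · simp
  · intro a _
    have h := congrArg Sigma.fst ((Sym.prodEquivSigmaMem α m).apply_symm_apply ⟨t, a⟩)
    exact congrArg (fun u : Sym α (m + 1) => ((u : Multiset α).map w).prod) h

theorem tsum_mul_tsumSym_le {α : Type*} (w : α → ℝ≥0∞) (m : ℕ) :
    (∑' a, w a) * tsumSym w m ≤ (m + 1) * tsumSym w (m + 1) := by
  classical
  rw [tsum_mul_tsumSym, tsumSym, ← ENNReal.tsum_mul_left]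
  refine ENNReal.tsum_le_tsum fun t => mul_le_mul_left ?_ _
  have h : (t : Multiset α).toFinset.card ≤ m + 1 :=
    (Multiset.toFinset_card_le _).trans t.2.le
  exact_mod_cast h

theorem tsum_card_repeated_mul_le {α : Type*} [DecidableEq α] (w : α → ℝ≥0∞)
    (hw : ∀ a, w a ≤ 1) (m : ℕ) :
    ∑' t : Sym α (m + 2),
      (((t : Multiset α).toFinset.filter fun a => 2 ≤ (t : Multiset α).count a).card : ℝ≥0∞) *
        ((t : Multiset α).map w).prod ≤ (∑' a, w a) * tsumSym w m := by
  have hmem : ∀ q : Σ t : Sym α (m + 2),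
      {a // a ∈ (t : Multiset α).toFinset.filter fun a => 2 ≤ (t : Multiset α).count a},
      q.2.1 ::ₘ q.2.1 ::ₘ (((q.1 : Multiset α).erase q.2.1).erase q.2.1) = q.1 := by
    rintro ⟨t, a, ha⟩
    have ha2 := (Finset.mem_filter.1 ha).2
    have h1 : a ∈ (t : Multiset α).erase a := by
      rw [← Multiset.count_pos, Multiset.count_erase_self]
      omega
    have h2 : a ∈ (t : Multiset α) := Multiset.mem_of_mem_erase h1
    simp only
    rw [Multiset.cons_erase h1, Multiset.cons_erase h2]
  let f : (Σ t : Sym α (m + 2),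
      {a // a ∈ (t : Multiset α).toFinset.filter fun a => 2 ≤ (t : Multiset α).count a}) →
      α × Sym α m := fun q =>
    (q.2.1, ⟨((q.1 : Multiset α).erase q.2.1).erase q.2.1, by
      have := congrArg Multiset.card (hmem q)
      rw [Multiset.card_cons, Multiset.card_cons, Sym.card_coe] at this
      omega⟩)
  have hf : Function.Injective f := by
    intro q q' h
    have ha : q.2.1 = q'.2.1 := congrArg Prod.fst h
    have hs := congrArg (fun p : α × Sym α m => (p.2 : Multiset α)) h
    change ((q.1 : Multiset α).erase q.2.1).erase q.2.1 =
      ((q'.1 : Multiset α).erase q'.2.1).erase q'.2.1 at hs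
    have ht : q.1 = q'.1 := by
      apply Sym.coe_injective
      rw [← hmem q, ← hmem q', hs, ha]
    obtain ⟨t, a⟩ := q
    obtain ⟨t', a'⟩ := q'
    simp only at ht ha
    subst ht
    rw [Subtype.ext ha]
  calc _ = ∑' q : Σ t : Sym α (m + 2),
        {a // a ∈ (t : Multiset α).toFinset.filter fun a => 2 ≤ (t : Multiset α).count a},
        ((q.1 : Multiset α).map w).prod := by
        rw [ENNReal.tsum_sigma']
        refine tsum_congr fun t => ?_
        rw [tsum_fintype]
        simp
    _ ≤ ∑' q, (fun p : α × Sym α m => w p.1 * ((p.2 : Multiset α).map w).prod) (f q) := by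
        refine ENNReal.tsum_le_tsum fun q => ?_
        conv_lhs => rw [← hmem q]
        rw [Multiset.map_cons, Multiset.map_cons, Multiset.prod_cons, Multiset.prod_cons]
        exact mul_le_of_le_one_left zero_le (hw _)
    _ ≤ ∑' p : α × Sym α m, w p.1 * ((p.2 : Multiset α).map w).prod :=
        ENNReal.tsum_comp_le_tsum_of_injective hf _
    _ = (∑' a, w a) * tsumSym w m := by
        rw [ENNReal.tsum_prod', tsumSym, ← ENNReal.tsum_mul_right]
        simp_rw [ENNReal.tsum_mul_left]

theorem tsumSym_add_two_le {α : Type*} (w : α → ℝ≥0∞) (hw : ∀ a, w a ≤ 1) (m : ℕ) :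
    (m + 2) * tsumSym w (m + 2) ≤
      (∑' a, w a) * tsumSym w (m + 1) + (m + 2) * ((∑' a, w a) * tsumSym w m) := by
  classical
  refine le_trans ?_ (add_le_add_right
    (mul_le_mul_right (tsum_card_repeated_mul_le w hw m) _) _)
  rw [tsum_mul_tsumSym, tsumSym, ← ENNReal.tsum_mul_left, ← ENNReal.tsum_mul_left,
    ← ENNReal.tsum_add]
  refine ENNReal.tsum_le_tsum fun t => ?_
  rw [← mul_assoc, ← add_mul]
  refine mul_le_mul_left ?_ _
  have hcard : ∑ a ∈ (t : Multiset α).toFinset, (t : Multiset α).count a = m + 2 := by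
    rw [Multiset.toFinset_sum_count_eq]; exact t.2
  have h : m + 2 ≤ (t : Multiset α).toFinset.card + (m + 2) *
      ((t : Multiset α).toFinset.filter fun a => 2 ≤ (t : Multiset α).count a).card := by
    rw [Finset.card_filter, Finset.card_eq_sum_ones, Finset.mul_sum, ← Finset.sum_add_distrib]
    conv_lhs => rw [← hcard]
    refine Finset.sum_le_sum fun a _ => ?_
    have h1 : (t : Multiset α).count a ≤ m + 2 := (Multiset.count_le_card _ _).trans t.2.le
    split_ifs <;> omega
  exact_mod_cast h

theorem tsumSym_ne_top {α : Type*} {w : α → ℝ≥0∞} (hw : ∀ a, w a ≤ 1)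
    (hfin : ∑' a, w a ≠ ⊤) (m : ℕ) : tsumSym w m ≠ ⊤ := by
  induction m using Nat.strong_induction_on with
  | _ m ih =>
    match m with
    | 0 => simp [tsumSym_zero]
    | 1 => rwa [tsumSym_one]
    | m + 2 =>
      have h0 := ih m (by omega)
      have h1 := ih (m + 1) (by omega)
      refine ne_top_of_le_ne_top ?_ ((le_mul_of_one_le_left zero_le ?_).trans
        (tsumSym_add_two_le w hw m))
      · finiteness
      · exact_mod_cast (by omega : 1 ≤ m + 2)

theorem tendsto_factorial_mul_tsumSym_div_pow {ι α : Type*} {l : Filter ι} {w : ι → α → ℝ≥0∞}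
    (hw : ∀ᶠ i in l, ∀ a, w i a ≤ 1) (hfin : ∀ᶠ i in l, ∑' a, w i a ≠ ⊤)
    (htop : Tendsto (fun i => (∑' a, w i a).toReal) l atTop) (m : ℕ) :
    Tendsto (fun i => m.factorial * (tsumSym (w i) m).toReal / (∑' a, w i a).toReal ^ m)
      l (𝓝 1) := by
  have hlow : ∀ m : ℕ, ∀ᶠ i in l,
      m.factorial * (tsumSym (w i) m).toReal / (∑' a, w i a).toReal ^ m ≤
        (m + 1).factorial * (tsumSym (w i) (m + 1)).toReal / (∑' a, w i a).toReal ^ (m + 1) := by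
    intro m
    filter_upwards [hw, hfin, htop.eventually_gt_atTop 0] with i hwi hfi hpos
    have h := ENNReal.toReal_mono
      (ENNReal.mul_ne_top (by finiteness) (tsumSym_ne_top hwi hfi (m + 1)))
      (tsum_mul_tsumSym_le (w i) m)
    rw [ENNReal.toReal_mul, ENNReal.toReal_mul, ENNReal.toReal_add (by finiteness) (by finiteness),
      ENNReal.toReal_natCast, ENNReal.toReal_one] at h
    rw [div_le_div_iff₀ (by positivity) (by positivity), Nat.factorial_succ]
    push_cast
    have h' := mul_le_mul_of_nonneg_left h
      (by positivity : 0 ≤ (m.factorial : ℝ) * (∑' a, w i a).toReal ^ m)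
    rw [pow_succ]
    linarith
  have hup : ∀ m : ℕ, ∀ᶠ i in l,
      (m + 2).factorial * (tsumSym (w i) (m + 2)).toReal / (∑' a, w i a).toReal ^ (m + 2) ≤
        (m + 1).factorial * (tsumSym (w i) (m + 1)).toReal / (∑' a, w i a).toReal ^ (m + 1) +
        (m + 2) * (m + 1) * (m.factorial * (tsumSym (w i) m).toReal /
          (∑' a, w i a).toReal ^ m) * ((∑' a, w i a).toReal)⁻¹ := by
    intro m
    filter_upwards [hw, hfin, htop.eventually_gt_atTop 0] with i hwi hfi hpos
    have h0 := tsumSym_ne_top hwi hfi m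
    have h1 := tsumSym_ne_top hwi hfi (m + 1)
    have h := ENNReal.toReal_mono (by finiteness) (tsumSym_add_two_le (w i) hwi m)
    rw [ENNReal.toReal_add (by finiteness) (by finiteness), ENNReal.toReal_mul,
      ENNReal.toReal_mul, ENNReal.toReal_mul, ENNReal.toReal_mul,
      ENNReal.toReal_add (by finiteness) (by finiteness),
      ENNReal.toReal_natCast, ENNReal.toReal_ofNat] at h
    generalize (∑' a, w i a).toReal = P at *
    rw [div_le_iff₀ (by positivity), Nat.factorial_succ (m + 1), Nat.factorial_succ m]
    push_cast
    have h' := mul_le_mul_of_nonneg_left h (by positivity : 0 ≤ (m.factorial : ℝ) * (m + 1))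
    refine le_trans (le_of_eq ?_) (h'.trans (le_of_eq ?_))
    · ring
    · field_simp
      ring
  have h0 : Tendsto (fun i => Nat.factorial 0 * (tsumSym (w i) 0).toReal /
      (∑' a, w i a).toReal ^ 0) l (𝓝 1) := by
    simpa [tsumSym_zero] using tendsto_const_nhds
  have h1 : Tendsto (fun i => Nat.factorial 1 * (tsumSym (w i) 1).toReal /
      (∑' a, w i a).toReal ^ 1) l (𝓝 1) := by
    refine tendsto_const_nhds.congr' ?_
    filter_upwards [htop.eventually_gt_atTop 0] with i hpos
    simp [tsumSym_one, hpos.ne']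
  induction m using Nat.strong_induction_on with
  | _ m ih =>
    match m with
    | 0 => exact h0
    | 1 => exact h1
    | m + 2 =>
      have h2 := ih (m + 1) (by omega)
      have h3 := h2.add (((ih m (by omega)).const_mul (((m : ℝ) + 2) * (m + 1))).mul
        htop.inv_tendsto_atTop)
      rw [mul_zero, add_zero] at h3
      exact tendsto_of_tendsto_of_tendsto_of_le_of_le' h2 h3 (hlow (m + 1)) (hup m)

theorem natCard_sym_odd_prime_eq_Qm (m k : ℕ) :
    Nat.card {s : Sym {p : ℕ // p.Prime ∧ Odd p} m //
      ((s : Multiset {p : ℕ // p.Prime ∧ Odd p}).map Subtype.val).sum = k} = Qm m k := by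
  refine Nat.card_congr (Equiv.ofBijective (fun s =>
    ⟨(s.1 : Multiset {p : ℕ // p.Prime ∧ Odd p}).map Subtype.val, ?_, ?_, s.2⟩) ⟨?_, ?_⟩)
  · rw [Multiset.card_map, Sym.card_coe]
  · intro p hp
    obtain ⟨q, -, rfl⟩ := Multiset.mem_map.1 hp
    exact q.2
  · intro s t h
    have := Multiset.map_injective Subtype.val_injective (congrArg Subtype.val h)
    exact Subtype.ext (Sym.coe_injective this)
  · rintro ⟨s, hcard, hp, hsum⟩
    lift s to Multiset {p : ℕ // p.Prime ∧ Odd p} using hp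
    rw [Multiset.card_map] at hcard
    exact ⟨⟨⟨s, hcard⟩, hsum⟩, rfl⟩

theorem finite_sym_odd_prime (m k : ℕ) :
    Finite {s : Sym {p : ℕ // p.Prime ∧ Odd p} m //
      ((s : Multiset {p : ℕ // p.Prime ∧ Odd p}).map Subtype.val).sum = k} := by
  refine Finite.of_injective (β := Nat.Partition k) (fun s =>
    ⟨(s.1 : Multiset {p : ℕ // p.Prime ∧ Odd p}).map Subtype.val, ?_, s.2⟩) ?_
  · intro p hp
    obtain ⟨q, -, rfl⟩ := Multiset.mem_map.1 hp
    exact q.2.1.pos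
  · intro s t h
    have := Multiset.map_injective Subtype.val_injective (congrArg Nat.Partition.parts h)
    exact Subtype.ext (Sym.coe_injective this)

theorem tsumSym_odd_prime_pow_eq (x : ℝ≥0∞) (m : ℕ) :
    tsumSym (fun p : {p : ℕ // p.Prime ∧ Odd p} => x ^ (p : ℕ)) m =
      ∑' k : ℕ, (Qm m k : ℝ≥0∞) * x ^ k := by
  rw [tsumSym, ← (Equiv.sigmaFiberEquiv fun s : Sym {p : ℕ // p.Prime ∧ Odd p} m =>
    ((s : Multiset {p : ℕ // p.Prime ∧ Odd p}).map Subtype.val).sum).tsum_eq, ENNReal.tsum_sigma']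
  refine tsum_congr fun k => ?_
  have := finite_sym_odd_prime m k
  have := Fintype.ofFinite {s : Sym {p : ℕ // p.Prime ∧ Odd p} m //
      ((s : Multiset {p : ℕ // p.Prime ∧ Odd p}).map Subtype.val).sum = k}
  rw [tsum_fintype, Finset.sum_congr rfl (g := fun _ => x ^ k)]
  · rw [Finset.sum_const, nsmul_eq_mul, ← natCard_sym_odd_prime_eq_Qm, Nat.card_eq_fintype_card,
      Finset.card_univ]
  · rintro ⟨s, rfl⟩ _
    change ((s : Multiset {p : ℕ // p.Prime ∧ Odd p}).map
      fun p : {p : ℕ // p.Prime ∧ Odd p} => x ^ (p : ℕ)).prod = _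
    induction (s : Multiset {p : ℕ // p.Prime ∧ Odd p}) using Multiset.induction_on with
    | empty => simp
    | cons a s ih => simp [ih, pow_add]

theorem gen_fun_m_parts_asymptotic (m : ℕ) (hm : 2 ≤ m) :
    Tendsto (fun z : ℝ =>
        (1 - z) ^ m * (Real.log (1 / (1 - z))) ^ m *
          ((Nat.factorial m : ℝ) * ∑' k : ℕ, (Qm m k : ℝ) * z ^ k))
      (𝓝[<] 1) (𝓝 1) := by
  set w : ℝ → {p : ℕ // p.Prime ∧ Odd p} → ℝ≥0∞ := fun z p => ENNReal.ofReal z ^ (p : ℕ) with hw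
  have hI := Ioo_mem_nhdsLT (zero_lt_one (α := ℝ))
  have hP : ∀ z ∈ Set.Ioo (0 : ℝ) 1, ∑' p, w z p =
      ENNReal.ofReal (∑' p : {p : ℕ // p.Prime ∧ Odd p}, z ^ (p : ℕ)) := by
    intro z hz
    rw [ENNReal.ofReal_tsum_of_nonneg (fun p => pow_nonneg hz.1.le _)
      ((summable_geometric_of_lt_one hz.1.le hz.2).subtype _)]
    exact tsum_congr fun p => (ENNReal.ofReal_pow hz.1.le _).symm
  have hPreal : ∀ z ∈ Set.Ioo (0 : ℝ) 1, (∑' p, w z p).toReal =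
      ∑' p : {p : ℕ // p.Prime ∧ Odd p}, z ^ (p : ℕ) := by
    intro z hz
    rw [hP z hz, ENNReal.toReal_ofReal (tsum_nonneg fun p => pow_nonneg hz.1.le _)]
  have hH : ∀ z ∈ Set.Ioo (0 : ℝ) 1,
      (tsumSym (w z) m).toReal = ∑' k : ℕ, (Qm m k : ℝ) * z ^ k := by
    intro z hz
    rw [hw, tsumSym_odd_prime_pow_eq, ENNReal.tsum_toReal_eq fun k => by finiteness]
    simp [ENNReal.toReal_ofReal hz.1.le]
  have htop : Tendsto (fun z => (∑' p, w z p).toReal) (𝓝[<] 1) atTop :=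
    tendsto_tsum_odd_prime_pow_atTop.congr' (by
      filter_upwards [hI] with z hz using (hPreal z hz).symm)
  have h1 := tendsto_factorial_mul_tsumSym_div_pow (l := 𝓝[<] (1 : ℝ)) (w := w)
    (by
      filter_upwards [hI] with z hz p
      exact pow_le_one₀ zero_le (ENNReal.ofReal_le_one.2 hz.2.le))
    (by
      filter_upwards [hI] with z hz
      rw [hP z hz]
      exact ENNReal.ofReal_ne_top) htop m
  have h2 := (tendsto_one_sub_mul_log_mul_tsum_odd_prime.pow m).mul h1
  rw [one_pow, one_mul] at h2
  refine h2.congr' ?_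
  filter_upwards [hI, htop.eventually_gt_atTop 0] with z hz hpos
  rw [← hPreal z hz, ← hH z hz]
  rw [mul_pow, mul_pow]
  field_simp
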